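/- Log-space Randomized Forward is a lower bound in expectation: if additionally the initial vector α_1 and all factors Φ_t are strictly positive (so that α̂_t(i) > 0 and Ẑ > 0 almost surely), then for every t and i, E[log α̂_t(i)] ≤ log α_t(i), and E[log Ẑ] ≤ log Z. -/

import Mathlib

open Finset

/-- Exact forward recursion, 0-based: `forwardAlpha α1 Φ (t-1)` is the paper's `α_t`. -/
def forwardAlpha {N : ℕ} (α1 : Fin N → ℝ) (Φ : ℕ → Fin N → Fin N → ℝ) :
    ℕ → Fin N → ℝ
  | 0 => α1
  | t + 1 => fun i => ∑ j, forwardAlpha α1 Φ t j * Φ t j i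

/-- Randomized forward recursion (Alg. 1), 0-based, for a fixed sample realization `δ`. -/
noncomputable def rforwardAlpha {N : ℕ} (K2 : ℕ) (α1 : Fin N → ℝ)
    (Φ : ℕ → Fin N → Fin N → ℝ) (Ω : ℕ → Finset (Fin N)) (q : ℕ → Fin N → ℝ)
    (δ : ℕ → Fin K2 → Fin N) : ℕ → Fin N → ℝ
  | 0 => α1
  | t + 1 => fun i =>
      (∑ σ ∈ Ω t, rforwardAlpha K2 α1 Φ Ω q δ t σ * Φ t σ i) +
        (1 / (K2 : ℝ)) *
          ∑ j, rforwardAlpha K2 α1 Φ Ω q δ t (δ t j) * Φ t (δ t j) i / q t (δ t j)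

section ProductWeights

variable {ι A : Type*} [Fintype ι] [DecidableEq ι] [Fintype A] {w : ι → A → ℝ}

lemma sum_prod_weights_eq_one (hw : ∀ i, ∑ a, w i a = 1) :
    ∑ δ : ι → A, ∏ i, w i (δ i) = 1 := by
  rw [← Fintype.prod_sum]
  simp [hw]

/-- Resampling one coordinate leaves the expectation under a product weight unchanged. -/
lemma sum_prod_weights_update (hw : ∀ i, ∑ a, w i a = 1) (s : ι) (h : (ι → A) → ℝ) :
    ∑ δ : ι → A, (∏ i, w i (δ i)) * h δ =
      ∑ δ : ι → A, (∏ i, w i (δ i)) * ∑ a, w s a * h (Function.update δ s a) := by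
  have swap : Function.Involutive
      (fun p : (ι → A) × A => (Function.update p.1 s p.2, p.1 s)) := by
    rintro ⟨δ, a⟩
    simp
  have weight (δ : ι → A) (a : A) :
      (∏ i, w i (Function.update δ s a i)) * w s (δ s) = (∏ i, w i (δ i)) * w s a := by
    rw [← mul_prod_erase univ (fun i => w i (Function.update δ s a i)) (mem_univ s),
      ← mul_prod_erase univ (fun i => w i (δ i)) (mem_univ s)]
    have : ∏ i ∈ univ.erase s, w i (Function.update δ s a i) =
        ∏ i ∈ univ.erase s, w i (δ i) :=
      prod_congr rfl fun i hi => by rw [Function.update_of_ne (ne_of_mem_erase hi)]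
    rw [this, Function.update_self]
    ring
  calc ∑ δ : ι → A, (∏ i, w i (δ i)) * h δ
      = ∑ p : (ι → A) × A, (∏ i, w i (p.1 i)) * w s p.2 * h p.1 := by
        rw [Fintype.sum_prod_type]
        refine sum_congr rfl fun δ _ => ?_
        dsimp only
        rw [← sum_mul, ← mul_sum, hw, mul_one]
    _ = ∑ p : (ι → A) × A,
          (∏ i, w i (p.1 i)) * w s p.2 * h (Function.update p.1 s p.2) := by
        rw [← Equiv.sum_comp swap.toPerm]
        refine sum_congr rfl fun p _ => ?_
        simp only [Function.Involutive.coe_toPerm]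
        rw [weight]
    _ = _ := by
        rw [Fintype.sum_prod_type]
        refine sum_congr rfl fun δ _ => ?_
        rw [mul_sum]
        exact sum_congr rfl fun a _ => mul_assoc _ _ _

lemma sum_prod_weights_eval (hw : ∀ i, ∑ a, w i a = 1) (s : ι) (g : A → ℝ) :
    ∑ δ : ι → A, (∏ i, w i (δ i)) * g (δ s) = ∑ a, w s a * g a := by
  rw [sum_prod_weights_update hw s]
  simp only [Function.update_self]
  rw [← sum_mul, sum_prod_weights_eq_one hw, one_mul]

end ProductWeights

/-- Jensen's inequality for `log` and finitely many weights; positivity of the random variable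
is only needed where the weight does not vanish. -/
lemma sum_weight_mul_log_le {κ : Type*} [Fintype κ] {W X : κ → ℝ} {m : ℝ}
    (hW : ∀ k, 0 ≤ W k) (hW1 : ∑ k, W k = 1) (hX : ∀ k, W k ≠ 0 → 0 < X k)
    (hm : 0 < m) (hmean : ∑ k, W k * X k = m) :
    ∑ k, W k * Real.log (X k) ≤ Real.log m := by
  have tangent (k : κ) :
      W k * Real.log (X k) ≤ W k * (Real.log m - 1) + W k * X k / m := by
    by_cases hk : W k = 0
    · simp [hk]
    have h := Real.log_le_sub_one_of_pos (div_pos (hX k hk) hm)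
    rw [Real.log_div (hX k hk).ne' hm.ne'] at h
    calc W k * Real.log (X k) ≤ W k * (Real.log m - 1 + X k / m) :=
          mul_le_mul_of_nonneg_left (by linarith) (hW k)
      _ = _ := by ring
  calc ∑ k, W k * Real.log (X k)
      ≤ ∑ k, (W k * (Real.log m - 1) + W k * X k / m) := sum_le_sum fun k _ => tangent k
    _ = Real.log m := by
        rw [sum_add_distrib, ← sum_mul, ← sum_div, hW1, hmean, div_self hm.ne']
        ring

/-- The randomized estimate of `∑ i, f i` that sums exactly over `S` and samples the rest. -/
noncomputable def partialSumEstimate {A : Type*} {K : ℕ} (S : Finset A) (p : A → ℝ) (f : A → ℝ)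
    (x : Fin K → A) : ℝ :=
  (∑ σ ∈ S, f σ) + (1 / (K : ℝ)) * ∑ j, f (x j) / p (x j)

section PartialSumEstimate

variable {A : Type*} {K : ℕ} {S : Finset A} {p f : A → ℝ}

lemma partialSumEstimate_pos (hK : 1 ≤ K) (hp : ∀ a, 0 ≤ p a) (hf : ∀ a, 0 < f a)
    {x : Fin K → A} (hx : ∀ j, p (x j) ≠ 0) : 0 < partialSumEstimate S p f x := by
  have : Nonempty (Fin K) := ⟨⟨0, hK⟩⟩
  have hK' : (0 : ℝ) < K := by exact_mod_cast hK
  refine add_pos_of_nonneg_of_pos (sum_nonneg fun a _ => (hf a).le)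
    (mul_pos (by positivity) (sum_pos (fun j _ => ?_) univ_nonempty))
  exact div_pos (hf _) ((hp _).lt_of_ne' (hx j))

lemma partialSumEstimate_unbiased [Fintype A] [DecidableEq A] (hK : 1 ≤ K)
    (hp_zero : ∀ a ∈ S, p a = 0) (hp_pos : ∀ a ∉ S, 0 < p a) (hp_sum : ∑ a, p a = 1) :
    ∑ x : Fin K → A, (∏ j, p (x j)) * partialSumEstimate S p f x = ∑ a, f a := by
  have hK' : (K : ℝ) ≠ 0 := by exact_mod_cast (by omega : K ≠ 0)
  have single : ∑ a, p a * (f a / p a) = ∑ a ∈ Sᶜ, f a := by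
    rw [← sum_add_sum_compl S, sum_eq_zero fun a ha => by rw [hp_zero a ha, zero_mul], zero_add]
    exact sum_congr rfl fun a ha => mul_div_cancel₀ _ (hp_pos a (mem_compl.mp ha)).ne'
  calc ∑ x : Fin K → A, (∏ j, p (x j)) * partialSumEstimate S p f x
      = (∑ x : Fin K → A, ∏ j, p (x j)) * ∑ σ ∈ S, f σ +
          (1 / (K : ℝ)) * ∑ j : Fin K, ∑ x : Fin K → A,
            (∏ j, p (x j)) * (f (x j) / p (x j)) := by
        rw [sum_comm, sum_mul, mul_sum, ← sum_add_distrib]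
        refine sum_congr rfl fun x _ => ?_
        rw [partialSumEstimate, ← mul_sum]
        ring
    _ = ∑ a, f a := by
        rw [sum_prod_weights_eq_one (w := fun _ : Fin K => p) fun _ => hp_sum]
        simp only [fun j => sum_prod_weights_eval (w := fun _ : Fin K => p) (fun _ => hp_sum) j
          (fun a => f a / p a), single]
        rw [sum_const, card_univ, Fintype.card_fin, nsmul_eq_mul, one_div,
          inv_mul_cancel_left₀ hK', one_mul, sum_add_sum_compl]

end PartialSumEstimate

section Forward

variable {N K2 T : ℕ} {α1 : Fin N → ℝ} {Φ : ℕ → Fin N → Fin N → ℝ}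
  {Ω : ℕ → Finset (Fin N)} {q : ℕ → Fin N → ℝ}

lemma rforwardAlpha_succ (δ : ℕ → Fin K2 → Fin N) (t : ℕ) (i : Fin N) :
    rforwardAlpha K2 α1 Φ Ω q δ (t + 1) i =
      partialSumEstimate (Ω t) (q t)
        (fun σ => rforwardAlpha K2 α1 Φ Ω q δ t σ * Φ t σ i) (δ t) := rfl

lemma rforwardAlpha_congr {δ ε : ℕ → Fin K2 → Fin N} {t : ℕ} (h : ∀ s < t, δ s = ε s) :
    rforwardAlpha K2 α1 Φ Ω q δ t = rforwardAlpha K2 α1 Φ Ω q ε t := by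
  induction t with
  | zero => rfl
  | succ t ih =>
    funext i
    rw [rforwardAlpha_succ, rforwardAlpha_succ, ih fun s hs => h s (by omega), h t (by omega)]

lemma forwardAlpha_pos (hN : 0 < N) (hα1 : ∀ i, 0 < α1 i) (hΦ : ∀ t i j, 0 < Φ t i j)
    (t : ℕ) (i : Fin N) : 0 < forwardAlpha α1 Φ t i := by
  have : Nonempty (Fin N) := ⟨⟨0, hN⟩⟩
  induction t generalizing i with
  | zero => exact hα1 i
  | succ t ih => exact sum_pos (fun j _ => mul_pos (ih j) (hΦ t j i)) univ_nonempty

lemma rforwardAlpha_pos (hK2 : 1 ≤ K2) (hα1 : ∀ i, 0 < α1 i) (hΦ : ∀ t i j, 0 < Φ t i j)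
    (hq : ∀ t i, 0 ≤ q t i) {δ : ℕ → Fin K2 → Fin N} {t : ℕ}
    (hδ : ∀ s < t, ∀ j, q s (δ s j) ≠ 0) (i : Fin N) :
    0 < rforwardAlpha K2 α1 Φ Ω q δ t i := by
  induction t generalizing i with
  | zero => exact hα1 i
  | succ t ih =>
    exact partialSumEstimate_pos hK2 (hq t)
      (fun σ => mul_pos (ih (fun s hs => hδ s (by omega)) σ) (hΦ t σ i)) (hδ t (by omega))

/-- Extend finitely many sample batches to a sequence by a constant batch. -/
def extendSamples (hN : 0 < N) (δ : Fin T → Fin K2 → Fin N) (s : ℕ) : Fin K2 → Fin N :=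
  if h : s < T then δ ⟨s, h⟩ else fun _ => ⟨0, hN⟩

lemma extendSamples_of_lt (hN : 0 < N) (δ : Fin T → Fin K2 → Fin N) {s : ℕ} (h : s < T) :
    extendSamples hN δ s = δ ⟨s, h⟩ := dif_pos h

lemma extendSamples_update_of_ne (hN : 0 < N) (δ : Fin T → Fin K2 → Fin N) (x : Fin K2 → Fin N)
    {s : ℕ} {t : Fin T} (h : s ≠ t) :
    extendSamples hN (Function.update δ t x) s = extendSamples hN δ s := by
  unfold extendSamples
  split
  · rw [Function.update_of_ne fun e => h (congrArg Fin.val e)]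
  · rfl

lemma sum_prod_proposal (hq_sum : ∀ t, ∑ i, q t i = 1) (t : ℕ) :
    ∑ x : Fin K2 → Fin N, ∏ j, q t (x j) = 1 :=
  sum_prod_weights_eq_one (w := fun _ : Fin K2 => q t) fun _ => hq_sum t

/-- One randomized summation step is unbiased, given the expectation of the current messages. -/
lemma sum_weight_mul_partialSumEstimate_rforwardAlpha (hN : 0 < N) (hK2 : 1 ≤ K2)
    (hq_zero : ∀ t, ∀ i ∈ Ω t, q t i = 0) (hq_pos : ∀ t, ∀ i ∉ Ω t, 0 < q t i)
    (hq_sum : ∀ t, ∑ i, q t i = 1) {t : ℕ} (ht : t < T) (c : Fin N → ℝ) :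
    ∑ δ : Fin T → Fin K2 → Fin N, (∏ s : Fin T, ∏ j : Fin K2, q s.1 (δ s j)) *
        partialSumEstimate (Ω t) (q t)
          (fun σ => rforwardAlpha K2 α1 Φ Ω q (extendSamples hN δ) t σ * c σ) (δ ⟨t, ht⟩) =
      ∑ σ, (∑ δ : Fin T → Fin K2 → Fin N, (∏ s : Fin T, ∏ j : Fin K2, q s.1 (δ s j)) *
        rforwardAlpha K2 α1 Φ Ω q (extendSamples hN δ) t σ) * c σ := by
  rw [sum_prod_weights_update (w := fun (s : Fin T) (x : Fin K2 → Fin N) => ∏ j, q s.1 (x j))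
    (fun s => sum_prod_proposal hq_sum s) ⟨t, ht⟩]
  simp only [sum_mul]
  rw [sum_comm]
  refine sum_congr rfl fun δ _ => ?_
  have past (x : Fin K2 → Fin N) :
      rforwardAlpha K2 α1 Φ Ω q (extendSamples hN (Function.update δ ⟨t, ht⟩ x)) t =
        rforwardAlpha K2 α1 Φ Ω q (extendSamples hN δ) t :=
    rforwardAlpha_congr fun s hs => extendSamples_update_of_ne hN δ x hs.ne
  simp only [past, Function.update_self]
  rw [partialSumEstimate_unbiased hK2 (hq_zero t) (hq_pos t) (hq_sum t), mul_sum]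
  exact sum_congr rfl fun σ _ => (mul_assoc _ _ _).symm

lemma sum_weight_mul_rforwardAlpha (hN : 0 < N) (hK2 : 1 ≤ K2)
    (hq_zero : ∀ t, ∀ i ∈ Ω t, q t i = 0) (hq_pos : ∀ t, ∀ i ∉ Ω t, 0 < q t i)
    (hq_sum : ∀ t, ∑ i, q t i = 1) {t : ℕ} (ht : t ≤ T) (i : Fin N) :
    ∑ δ : Fin T → Fin K2 → Fin N, (∏ s : Fin T, ∏ j : Fin K2, q s.1 (δ s j)) *
        rforwardAlpha K2 α1 Φ Ω q (extendSamples hN δ) t i = forwardAlpha α1 Φ t i := by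
  induction t generalizing i with
  | zero =>
    simp only [rforwardAlpha, forwardAlpha]
    rw [← sum_mul, sum_prod_weights_eq_one
      (w := fun (s : Fin T) (x : Fin K2 → Fin N) => ∏ j, q s.1 (x j))
      (fun s => sum_prod_proposal hq_sum s), one_mul]
  | succ t ih =>
    simp only [rforwardAlpha_succ, extendSamples_of_lt hN _ (show t < T from ht)]
    rw [sum_weight_mul_partialSumEstimate_rforwardAlpha hN hK2 hq_zero hq_pos hq_sum ht]
    simp only [ih (by omega : t ≤ T), forwardAlpha]

end Forward

/-- log-space Randomized Forward is a lower bound in expectation.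
If the initial vector and all factors are strictly positive, then for every step
`t ∈ {1,…,T}` (0-based: `t < T`) and state `i`, `E[log α̂_t(i)] ≤ log α_t(i)`, and
`E[log Ẑ] ≤ log Z`. Expectations are explicit weighted sums over all sample
realizations `δ : Fin T → Fin K2 → Fin N` with i.i.d. weights `∏_{s,j} q_s(δ_{s,j})`. -/
theorem randomized_forward_log_lower_bound
    (N T K2 : ℕ) (hN : 0 < N) (hT : 1 ≤ T) (hK2 : 1 ≤ K2)
    (α1 : Fin N → ℝ) (hα1 : ∀ i, 0 < α1 i)
    (Φ : ℕ → Fin N → Fin N → ℝ) (hΦ : ∀ t i j, 0 < Φ t i j)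
    (Ω : ℕ → Finset (Fin N)) (q : ℕ → Fin N → ℝ)
    (hq_zero : ∀ t, ∀ i ∈ Ω t, q t i = 0)
    (hq_pos : ∀ t, ∀ i ∉ Ω t, 0 < q t i)
    (hq_sum : ∀ t, ∑ i, q t i = 1) :
    (∀ t < T, ∀ i : Fin N,
        ∑ δ : Fin T → Fin K2 → Fin N,
            (∏ s : Fin T, ∏ j : Fin K2, q s.1 (δ s j)) *
              Real.log
                (rforwardAlpha K2 α1 Φ Ω q
                  (fun s => if h : s < T then δ ⟨s, h⟩ else fun _ => ⟨0, hN⟩) t i) ≤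
          Real.log (forwardAlpha α1 Φ t i)) ∧
      ∑ δ : Fin T → Fin K2 → Fin N,
          (∏ s : Fin T, ∏ j : Fin K2, q s.1 (δ s j)) *
            Real.log
              ((∑ σ ∈ Ω (T - 1),
                  rforwardAlpha K2 α1 Φ Ω q
                    (fun s => if h : s < T then δ ⟨s, h⟩ else fun _ => ⟨0, hN⟩)
                    (T - 1) σ) +
                (1 / (K2 : ℝ)) *
                  ∑ j, rforwardAlpha K2 α1 Φ Ω q
                      (fun s => if h : s < T then δ ⟨s, h⟩ else fun _ => ⟨0, hN⟩)
                      (T - 1) (δ ⟨T - 1, by omega⟩ j) /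
                    q (T - 1) (δ ⟨T - 1, by omega⟩ j)) ≤
        Real.log (∑ i, forwardAlpha α1 Φ (T - 1) i) := by
  have hq (t : ℕ) (i : Fin N) : 0 ≤ q t i := by
    by_cases h : i ∈ Ω t
    · exact (hq_zero t i h).ge
    · exact (hq_pos t i h).le
  have weight_nonneg (δ : Fin T → Fin K2 → Fin N) :
      0 ≤ ∏ s : Fin T, ∏ j : Fin K2, q s.1 (δ s j) :=
    prod_nonneg fun s _ => prod_nonneg fun j _ => hq s _
  have weight_sum : ∑ δ : Fin T → Fin K2 → Fin N,
      ∏ s : Fin T, ∏ j : Fin K2, q s.1 (δ s j) = 1 :=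
    sum_prod_weights_eq_one (w := fun (s : Fin T) (x : Fin K2 → Fin N) => ∏ j, q s.1 (x j))
      fun s => sum_prod_proposal hq_sum s
  have support {δ : Fin T → Fin K2 → Fin N}
      (hδ : ∏ s : Fin T, ∏ j : Fin K2, q s.1 (δ s j) ≠ 0) (s : Fin T) (j : Fin K2) :
      q s.1 (δ s j) ≠ 0 :=
    prod_ne_zero_iff.mp (prod_ne_zero_iff.mp hδ s (mem_univ s)) j (mem_univ j)
  have message_pos {δ : Fin T → Fin K2 → Fin N}
      (hδ : ∏ s : Fin T, ∏ j : Fin K2, q s.1 (δ s j) ≠ 0) {t : ℕ} (ht : t < T) (i : Fin N) :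
      0 < rforwardAlpha K2 α1 Φ Ω q (extendSamples hN δ) t i := by
    refine rforwardAlpha_pos hK2 hα1 hΦ hq (fun s hs j => ?_) i
    rw [extendSamples_of_lt hN δ (hs.trans ht)]
    exact support hδ ⟨s, hs.trans ht⟩ j
  have hlast : T - 1 < T := by omega
  refine ⟨fun t ht i => ?_, ?_⟩
  · exact sum_weight_mul_log_le weight_nonneg weight_sum
      (fun δ hδ => message_pos hδ ht i) (forwardAlpha_pos hN hα1 hΦ t i)
      (sum_weight_mul_rforwardAlpha hN hK2 hq_zero hq_pos hq_sum ht.le i)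
  · have mean := sum_weight_mul_partialSumEstimate_rforwardAlpha (α1 := α1) (Φ := Φ) hN hK2
      hq_zero hq_pos hq_sum hlast (fun _ => 1)
    simp only [mul_one,
      sum_weight_mul_rforwardAlpha hN hK2 hq_zero hq_pos hq_sum hlast.le] at mean
    have : Nonempty (Fin N) := ⟨⟨0, hN⟩⟩
    exact sum_weight_mul_log_le weight_nonneg weight_sum
      (fun δ hδ => partialSumEstimate_pos hK2 (hq (T - 1)) (message_pos hδ hlast)
        (support hδ ⟨T - 1, hlast⟩))
      (sum_pos (fun i _ => forwardAlpha_pos hN hα1 hΦ (T - 1) i) univ_nonempty) mean
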